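/- arXiv:1708.09378 — 4 statements merged into one kernel-verified Lean document; each statement's English description precedes it below -/
import Mathlib

section
/- Let g ≥ 1, r, d ≥ 0 be integers and let α = (α_0,…,α_r), β = (β_0,…,β_r) be nondecreasing sequences of nonnegative integers. Let σ = {(x,y) ∈ ℤ² : 0 ≤ y ≤ r, −α_y ≤ x < g−d+r+β_{r−y}}, and set λ^1 = (−α_0,…,−α_r) and ρ^g = (g−d+r+β_r, g−d+r+β_{r−1}, …, g−d+r+β_0). Then Σ_{P ∈ PT(λ^1,ρ^g)} μ(P)·χ(P) = (−1)^{g−|σ|} · #{standard set-valued tableaux of shape σ with content {1,…,g}}. -/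
namespace Pont

/-- The set of boxes of a nonincreasing `(r+1)`-tuple `l`: all `(x,y)` with `x < l y`. -/
def boxes (r : ℕ) (l : Fin (r + 1) → ℤ) : Set (ℤ × Fin (r + 1)) := {b | b.1 < l b.2}

/-- `b` is an inward corner of `l`: a minimal box not in `l` for the componentwise order. -/
def IsInwardCorner (r : ℕ) (l : Fin (r + 1) → ℤ) (b : ℤ × Fin (r + 1)) : Prop :=
  b ∉ boxes r l ∧ ∀ b' : ℤ × Fin (r + 1), b' ∉ boxes r l → b'.1 ≤ b.1 → b'.2 ≤ b.2 → b' = b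

/-- `l ∪ b`: the tuple obtained by increasing `l` by `1` in the row of `b`. -/
def addBox (r : ℕ) (l : Fin (r + 1) → ℤ) (b : ℤ × Fin (r + 1)) : Fin (r + 1) → ℤ :=
  fun y => if y = b.2 then l y + 1 else l y

/-- Raw data of a pontableau sequence `(λ¹, ρ¹, …, λᵍ, ρᵍ)`; `lam n`, `rho n` are only
meaningful for `1 ≤ n ≤ g`, and are normalised to `0` elsewhere. -/
structure PontSeq (r : ℕ) where
  lam : ℕ → Fin (r + 1) → ℤ
  rho : ℕ → Fin (r + 1) → ℤ

/-- The conditions defining a pontableau sequence. -/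
def ValidPont (r g : ℕ) (P : PontSeq r) : Prop :=
  (∀ n, 1 ≤ n → n ≤ g → Antitone (P.lam n) ∧ Antitone (P.rho n)) ∧
  (∀ n, 1 ≤ n → n + 1 ≤ g → boxes r (P.lam (n + 1)) ⊆ boxes r (P.rho n)) ∧
  (∀ n, 1 ≤ n → n ≤ g →
    boxes r (P.rho n) ⊆ boxes r (P.lam n) ∨
      ∃ b, IsInwardCorner r (P.lam n) b ∧
        boxes r (P.rho n) ⊆ boxes r (addBox r (P.lam n) b)) ∧
  (∀ n, n = 0 ∨ g < n → P.lam n = 0 ∧ P.rho n = 0)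

/-- `PT(λ¹, ρᵍ)`: pontableaux with prescribed first tuple `λ¹` and last tuple `ρᵍ`. -/
def PT (r g : ℕ) (l1 rg : Fin (r + 1) → ℤ) : Set (PontSeq r) :=
  {P | ValidPont r g P ∧ P.lam 1 = l1 ∧ P.rho g = rg}

/-- The boxes carrying the left-removal `−n`, namely `ρ^{n−1} ∖ λ^n`. -/
def lrs (r : ℕ) (P : PontSeq r) (n : ℕ) : Set (ℤ × Fin (r + 1)) :=
  boxes r (P.rho (n - 1)) \ boxes r (P.lam n)

open Classical in
/-- `μ(P)`: zero if some left-removal `−n` occurs in two (horizontally or vertically)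
adjacent boxes, and otherwise `(−1)^L` where `L` is the total number of left-removals. -/
noncomputable def mu (r g : ℕ) (P : PontSeq r) : ℤ :=
  if ∃ n, 2 ≤ n ∧ n ≤ g ∧ ∃ b ∈ lrs r P n,
      ((b.1 + 1, b.2) ∈ lrs r P n ∨
        ∃ y' : Fin (r + 1), (y' : ℕ) = (b.2 : ℕ) + 1 ∧ (b.1, y') ∈ lrs r P n)
  then 0
  else (-1) ^ ∑ n ∈ Finset.Icc 2 g, (lrs r P n).ncard

open Classical in
/-- `χ(P)`: `1` if every augmentation `n ∈ {1,…,g}` occurs in some box (i.e. each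
`ρ^n ∖ λ^n` is nonempty), and `0` otherwise. -/
noncomputable def chi (r g : ℕ) (P : PontSeq r) : ℤ :=
  if ∀ n, 1 ≤ n → n ≤ g → (boxes r (P.rho n) \ boxes r (P.lam n)).Nonempty then 1 else 0

/-- The skew shape `σ(g,r,d,α,β)`. -/
def sigmaShape (g r d : ℕ) (α β : Fin (r + 1) → ℕ) : Set (ℤ × ℤ) :=
  {p | ∃ y : Fin (r + 1), p.2 = (y : ℤ) ∧
    -(α y : ℤ) ≤ p.1 ∧ p.1 < (g : ℤ) - d + r + (β y.rev : ℤ)}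

/-- `T` is a standard set-valued tableau of shape `σ` with content `{1,…,g}`. -/
def IsStdSVT (g : ℕ) (σ : Set (ℤ × ℤ)) (T : ℤ × ℤ → Finset ℕ) : Prop :=
  (∀ b, b ∉ σ → T b = ∅) ∧ (∀ b ∈ σ, (T b).Nonempty) ∧
  (∀ x y : ℤ, (x, y) ∈ σ → (x + 1, y) ∈ σ → ∀ a ∈ T (x, y), ∀ c ∈ T (x + 1, y), a ≤ c) ∧
  (∀ x y : ℤ, (x, y) ∈ σ → (x, y + 1) ∈ σ → ∀ a ∈ T (x, y), ∀ c ∈ T (x, y + 1), a < c) ∧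
  (∀ b b' : ℤ × ℤ, b ∈ σ → b' ∈ σ → b ≠ b' → Disjoint (T b) (T b')) ∧
  (∀ k : ℕ, (∃ b, k ∈ T b) ↔ 1 ≤ k ∧ k ≤ g)

end Pont

namespace Pont

open Finset

section Labellings

/-- `f` labels the boxes of `s` by `Fin n`, each box receiving at least one label, with labels
increasing along rows and columns. -/
def IsLabelling (n : ℕ) (s : Finset (ℤ × ℤ)) (f : Fin n → ℤ × ℤ) : Prop :=
  (∀ b, b ∈ s ↔ ∃ i, f i = b) ∧ (∀ i j, f j = f i + (1, 0) → i < j) ∧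
    ∀ i j, f j = f i + (0, 1) → i < j

open Classical in
/-- The finite set of labellings of `s` by `Fin n`. -/
noncomputable def labellings (n : ℕ) (s : Finset (ℤ × ℤ)) : Finset (Fin n → ℤ × ℤ) :=
  (Fintype.piFinset fun _ => s).filter (IsLabelling n s)

lemma mem_labellings {n : ℕ} {s : Finset (ℤ × ℤ)} {f : Fin n → ℤ × ℤ} :
    f ∈ labellings n s ↔ IsLabelling n s f := by
  simp only [labellings, mem_filter, Fintype.mem_piFinset, and_iff_right_iff_imp]
  intro h i
  exact (h.1 _).2 ⟨i, rfl⟩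

/-- The boxes of `s` with no left and no upper neighbour in `s`. -/
def minimalBoxes (s : Finset (ℤ × ℤ)) : Finset (ℤ × ℤ) :=
  s.filter fun b => b - (1, 0) ∉ s ∧ b - (0, 1) ∉ s

lemma isLabelling_cons {n : ℕ} {s : Finset (ℤ × ℤ)} {b : ℤ × ℤ} {f : Fin n → ℤ × ℤ} :
    IsLabelling (n + 1) s (Fin.cons b f : Fin (n + 1) → ℤ × ℤ) ↔
      b ∈ minimalBoxes s ∧ (IsLabelling n s f ∨ IsLabelling n (s.erase b) f) := by
  have h10 : ∀ c : ℤ × ℤ, c ≠ c + (1, 0) := fun c h => by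
    have := congrArg Prod.fst h; simp at this
  have h01 : ∀ c : ℤ × ℤ, c ≠ c + (0, 1) := fun c h => by
    have := congrArg Prod.snd h; simp at this
  simp only [IsLabelling, minimalBoxes, mem_filter, Fin.exists_fin_succ, Fin.forall_fin_succ,
    Fin.cons_zero, Fin.cons_succ, mem_erase]
  constructor
  · rintro ⟨hs, ⟨⟨-, -⟩, hr⟩, ⟨⟨-, -⟩, hd⟩⟩
    have hb : b ∈ s := (hs b).2 (Or.inl rfl)
    refine ⟨⟨hb, fun h => ?_, fun h => ?_⟩, ?_⟩
    · rcases (hs _).1 h with h | ⟨i, hi⟩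
      · exact h10 b (eq_sub_iff_add_eq.1 h).symm
      · exact absurd ((hr i).1 (by rw [hi]; simp)) (by simp)
    · rcases (hs _).1 h with h | ⟨i, hi⟩
      · exact h01 b (eq_sub_iff_add_eq.1 h).symm
      · exact absurd ((hd i).1 (by rw [hi]; simp)) (by simp)
    · have hr' : ∀ i j, f j = f i + (1, 0) → i < j := fun i j h => by
        simpa using (hr i).2 j h
      have hd' : ∀ i j, f j = f i + (0, 1) → i < j := fun i j h => by
        simpa using (hd i).2 j h
      by_cases hbf : ∃ i, f i = b
      · refine Or.inl ⟨fun c => ⟨fun hc => ?_, fun hc => (hs c).2 (Or.inr hc)⟩, hr', hd'⟩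
        rcases (hs c).1 hc with rfl | h
        · exact hbf
        · exact h
      · refine Or.inr ⟨fun c => ⟨fun hc => ?_, fun hc => ⟨?_, (hs c).2 (Or.inr hc)⟩⟩, hr', hd'⟩
        · rcases (hs c).1 hc.2 with h | h
          · exact absurd h.symm hc.1
          · exact h
        · rintro rfl
          exact hbf hc
  · rintro ⟨⟨hb, hl, hu⟩, h⟩
    have hfs : ∀ i, f i ∈ s := by
      intro i
      rcases h with h | h
      · exact (h.1 _).2 ⟨i, rfl⟩
      · exact ((h.1 _).2 ⟨i, rfl⟩).2
    have hrd : (∀ i j, f j = f i + (1, 0) → i < j) ∧ ∀ i j, f j = f i + (0, 1) → i < j := by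
      rcases h with h | h <;> exact h.2
    refine ⟨fun c => ⟨fun hc => ?_, ?_⟩, ⟨⟨fun h => absurd h (h10 b), fun i _ => ?_⟩, fun i =>
      ⟨fun h => ?_, fun j h => ?_⟩⟩, ⟨⟨fun h => absurd h (h01 b), fun i _ => ?_⟩, fun i =>
      ⟨fun h => ?_, fun j h => ?_⟩⟩⟩
    · by_cases hcb : b = c
      · exact Or.inl hcb
      · rcases h with h | h
        · exact Or.inr ((h.1 c).1 hc)
        · exact Or.inr ((h.1 c).1 ⟨Ne.symm hcb, hc⟩)
    · rintro (rfl | ⟨i, rfl⟩)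
      · exact hb
      · exact hfs i
    · exact Fin.succ_pos i
    · exact absurd (hfs i) (by rw [eq_sub_of_add_eq h.symm]; exact hl)
    · simpa using hrd.1 i j h
    · exact Fin.succ_pos i
    · exact absurd (hfs i) (by rw [eq_sub_of_add_eq h.symm]; exact hu)
    · simpa using hrd.2 i j h

lemma card_labellings_succ (n : ℕ) (s : Finset (ℤ × ℤ)) :
    #(labellings (n + 1) s) =
      ∑ b ∈ minimalBoxes s, (#(labellings n (s.erase b)) + #(labellings n s)) := by
  classical
  have hmap : Set.MapsTo (fun f : Fin (n + 1) → ℤ × ℤ => f 0) (labellings (n + 1) s)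
      (minimalBoxes s) := by
    intro f hf
    rw [mem_coe, mem_labellings, ← Fin.cons_self_tail f] at hf
    exact (isLabelling_cons.1 hf).1
  rw [card_eq_sum_card_fiberwise hmap]
  refine sum_congr rfl fun b hb => ?_
  have hdis : Disjoint (labellings n (s.erase b)) (labellings n s) := by
    rw [Finset.disjoint_left]
    intro f h1 h2
    rw [mem_labellings] at h1 h2
    have := (h1.1 b).2 ((h2.1 b).1 (mem_filter.1 hb).1)
    simp at this
  rw [← card_union_of_disjoint hdis,
    ← card_image_of_injective (labellings n (s.erase b) ∪ labellings n s)
      (Fin.cons_right_injective (α := fun _ => ℤ × ℤ) b)]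
  congr 1
  ext f
  simp only [mem_filter, mem_image, mem_union, mem_labellings]
  constructor
  · rintro ⟨hf, rfl⟩
    refine ⟨Fin.tail f, ?_, Fin.cons_self_tail f⟩
    rw [← Fin.cons_self_tail f] at hf
    exact (isLabelling_cons.1 hf).2.symm
  · rintro ⟨f, hf, rfl⟩
    exact ⟨isLabelling_cons.2 ⟨hb, hf.symm⟩, rfl⟩

lemma card_le_of_mem_labellings {n : ℕ} {s : Finset (ℤ × ℤ)} {f : Fin n → ℤ × ℤ}
    (hf : f ∈ labellings n s) : #s ≤ n := by
  classical
  rw [mem_labellings] at hf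
  have : s ⊆ univ.image f := fun b hb => by simpa using (hf.1 b).1 hb
  simpa using (card_le_card this).trans card_image_le

/-- The number of labellings of `s`, with sign. -/
noncomputable def signedCount (n : ℕ) (s : Finset (ℤ × ℤ)) : ℤ :=
  (-1) ^ (n + #s) * #(labellings n s)

lemma signedCount_zero (s : Finset (ℤ × ℤ)) : signedCount 0 s = if s = ∅ then 1 else 0 := by
  split_ifs with hs
  · subst hs
    have : labellings 0 ∅ = univ := by
      ext f
      simpa [mem_labellings, IsLabelling] using Subsingleton.elim _ _
    simp [signedCount, this]
  · have : labellings 0 s = ∅ := by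
      rw [eq_empty_iff_forall_notMem]
      intro f hf
      have := card_le_of_mem_labellings hf
      simp at this
      exact hs this
    simp [signedCount, this]

lemma signedCount_succ (n : ℕ) (s : Finset (ℤ × ℤ)) :
    signedCount (n + 1) s =
      ∑ b ∈ minimalBoxes s, (signedCount n (s.erase b) - signedCount n s) := by
  unfold signedCount
  rw [card_labellings_succ, Nat.cast_sum, mul_sum]
  refine sum_congr rfl fun b hb => ?_
  have h := card_erase_add_one (mem_filter.1 hb).1
  rw [← h]
  push_cast
  ring

lemma signedCount_eq (n : ℕ) (s : Finset (ℤ × ℤ)) :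
    signedCount n s = (-1) ^ (n - #s) * #(labellings n s) := by
  rcases (labellings n s).eq_empty_or_nonempty with h | ⟨f, hf⟩
  · simp [signedCount, h]
  · obtain ⟨k, rfl⟩ := Nat.exists_eq_add_of_le (card_le_of_mem_labellings hf)
    rw [signedCount, Nat.add_sub_cancel_left, add_right_comm, pow_add, ← two_mul, pow_mul]
    simp

/-- The set-valued filling attached to a labelling, with labels shifted to start at `1`. -/
def toFilling {n : ℕ} (f : Fin n → ℤ × ℤ) (b : ℤ × ℤ) : Finset ℕ :=
  (univ.filter fun i => f i = b).image fun i : Fin n => (i : ℕ) + 1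

lemma mem_toFilling {n : ℕ} {f : Fin n → ℤ × ℤ} {b : ℤ × ℤ} {k : ℕ} :
    k ∈ toFilling f b ↔ ∃ i, f i = b ∧ (i : ℕ) + 1 = k := by
  simp [toFilling]

lemma toFilling_injective (n : ℕ) : Function.Injective (toFilling (n := n)) := by
  intro f f' h
  funext i
  have : (i : ℕ) + 1 ∈ toFilling f' (f i) := by
    rw [← h]
    exact mem_toFilling.2 ⟨i, rfl, rfl⟩
  obtain ⟨j, hj, hij⟩ := mem_toFilling.1 this
  rw [← hj, Fin.ext (Nat.succ_injective hij)]

lemma isStdSVT_iff {n : ℕ} {s : Finset (ℤ × ℤ)} {T : ℤ × ℤ → Finset ℕ} :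
    IsStdSVT n s T ↔ ∃ f, IsLabelling n s f ∧ toFilling f = T := by
  constructor
  · rintro ⟨hout, hne, hrow, hcol, hdis, hcont⟩
    have hex : ∀ i : Fin n, ∃ b, (i : ℕ) + 1 ∈ T b := fun i => (hcont _).2 ⟨by simp, i.2⟩
    choose f hf using hex
    have hmem : ∀ b k, k ∈ T b → b ∈ s := by
      intro b k hk
      by_contra hb
      rw [hout b (by simpa using hb)] at hk
      simp at hk
    have huniq : ∀ b b' k, k ∈ T b → k ∈ T b' → b = b' := by
      intro b b' k h h'
      by_contra hbb
      exact Finset.disjoint_left.1 (hdis b b' (hmem b k h) (hmem b' k h') hbb) h h'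
    have hT : toFilling f = T := by
      funext b
      ext k
      rw [mem_toFilling]
      constructor
      · rintro ⟨i, rfl, rfl⟩
        exact hf i
      · intro hk
        obtain ⟨h1, h2⟩ := (hcont k).1 ⟨b, hk⟩
        refine ⟨⟨k - 1, by omega⟩, ?_, Nat.sub_add_cancel h1⟩
        refine huniq _ _ k ?_ hk
        have := hf ⟨k - 1, by omega⟩
        simpa [Nat.sub_add_cancel h1] using this
    refine ⟨f, ⟨fun b => ⟨fun hb => ?_, ?_⟩, fun i j hij => ?_, fun i j hij => ?_⟩, hT⟩
    · obtain ⟨k, hk⟩ := hne b hb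
      rw [← hT] at hk
      obtain ⟨i, hi, -⟩ := mem_toFilling.1 hk
      exact ⟨i, hi⟩
    · rintro ⟨i, rfl⟩
      exact hmem _ _ (hf i)
    · have hi := hf i
      have hj := hf j
      rw [hij, show f i + (1, 0) = ((f i).1 + 1, (f i).2) by ext <;> simp] at hj
      have hle := hrow (f i).1 (f i).2 (hmem _ _ hi)
        (hmem _ _ hj) _ hi _ hj
      have hne : i ≠ j := by
        rintro rfl
        have := congrArg Prod.fst hij
        simp at this
      exact lt_of_le_of_ne (by simpa using hle) hne
    · have hi := hf i
      have hj := hf j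
      rw [hij, show f i + (0, 1) = ((f i).1, (f i).2 + 1) by ext <;> simp] at hj
      have hlt := hcol (f i).1 (f i).2 (hmem _ _ hi)
        (hmem _ _ hj) _ hi _ hj
      simpa using hlt
  · rintro ⟨f, ⟨hs, hr, hd⟩, rfl⟩
    refine ⟨fun b hb => ?_, fun b hb => ?_, fun x y _ _ a ha c hc => ?_,
      fun x y _ _ a ha c hc => ?_, fun b b' _ _ hbb => ?_, fun k => ?_⟩
    · rw [eq_empty_iff_forall_notMem]
      intro k hk
      obtain ⟨i, hi, -⟩ := mem_toFilling.1 hk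
      exact hb (by simpa using (hs b).2 ⟨i, hi⟩)
    · obtain ⟨i, hi⟩ := (hs b).1 (by simpa using hb)
      exact ⟨_, mem_toFilling.2 ⟨i, hi, rfl⟩⟩
    · obtain ⟨i, hi, rfl⟩ := mem_toFilling.1 ha
      obtain ⟨j, hj, rfl⟩ := mem_toFilling.1 hc
      have := hr i j (by rw [hi, hj]; simp)
      have : (i : ℕ) < j := this
      omega
    · obtain ⟨i, hi, rfl⟩ := mem_toFilling.1 ha
      obtain ⟨j, hj, rfl⟩ := mem_toFilling.1 hc
      have := hd i j (by rw [hi, hj]; simp)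
      have : (i : ℕ) < j := this
      omega
    · rw [Finset.disjoint_left]
      intro k h h'
      obtain ⟨i, hi, rfl⟩ := mem_toFilling.1 h
      obtain ⟨j, hj, hij⟩ := mem_toFilling.1 h'
      rw [Fin.ext (Nat.succ_injective hij)] at hj
      exact hbb (hi.symm.trans hj)
    · constructor
      · rintro ⟨b, hb⟩
        obtain ⟨i, -, rfl⟩ := mem_toFilling.1 hb
        exact ⟨by omega, i.2⟩
      · rintro ⟨h1, h2⟩
        exact ⟨_, mem_toFilling.2 ⟨⟨k - 1, by omega⟩, rfl, Nat.sub_add_cancel h1⟩⟩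

lemma ncard_isStdSVT (n : ℕ) (s : Finset (ℤ × ℤ)) :
    {T | IsStdSVT n s T}.ncard = #(labellings n s) := by
  rw [← Set.ncard_coe_finset, ← Set.ncard_image_of_injective _ (toFilling_injective n)]
  congr 1
  ext T
  simp [isStdSVT_iff, mem_labellings]

end Labellings

section SkewShapes

variable {r : ℕ}

/-- Row `y` of the tuple `l` ends in an inward corner. -/
def IsCornerRow (l : Fin (r + 1) → ℤ) (y : Fin (r + 1)) : Prop := ∀ z < y, l y < l z

/-- Lengthen row `y` of `l` by one box. -/
def growRow (l : Fin (r + 1) → ℤ) (y : Fin (r + 1)) : Fin (r + 1) → ℤ :=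
  fun z => if z = y then l z + 1 else l z

open Classical in
/-- The rows of `l` ending in an inward corner. -/
noncomputable def cornerRows (l : Fin (r + 1) → ℤ) : Finset (Fin (r + 1)) :=
  univ.filter (IsCornerRow l)

lemma mem_cornerRows {l : Fin (r + 1) → ℤ} {y : Fin (r + 1)} :
    y ∈ cornerRows l ↔ IsCornerRow l y := by
  simp [cornerRows]

lemma antitone_growRow {l : Fin (r + 1) → ℤ} {y : Fin (r + 1)} (hl : Antitone l)
    (hy : IsCornerRow l y) : Antitone (growRow l y) := by
  intro a b hab
  have h := hl hab
  unfold growRow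
  split_ifs with h1 h2 h2
  · omega
  · subst h1
    have := hy a (lt_of_le_of_ne hab h2)
    omega
  · omega
  · exact h

lemma le_growRow (l : Fin (r + 1) → ℤ) (y : Fin (r + 1)) : l ≤ growRow l y := by
  intro z
  change l z ≤ growRow l y z
  unfold growRow
  split_ifs <;> omega

lemma growRow_le_add_one (l : Fin (r + 1) → ℤ) (y z : Fin (r + 1)) : growRow l y z ≤ l z + 1 := by
  unfold growRow
  split_ifs <;> omega

/-- The boxes of the skew shape between the tuples `l` and `m`. -/
noncomputable def skewShape (l m : Fin (r + 1) → ℤ) : Finset (ℤ × ℤ) :=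
  univ.biUnion fun y => (Ico (l y) (m y)).image fun x => (x, (y : ℤ))

lemma mem_skewShape {l m : Fin (r + 1) → ℤ} {p : ℤ × ℤ} :
    p ∈ skewShape l m ↔ ∃ y : Fin (r + 1), p.2 = (y : ℤ) ∧ l y ≤ p.1 ∧ p.1 < m y := by
  obtain ⟨x, z⟩ := p
  simp only [skewShape, mem_biUnion, mem_univ, true_and, mem_image, mem_Ico, Prod.mk.injEq]
  constructor
  · rintro ⟨y, x, h, rfl, rfl⟩
    exact ⟨y, rfl, h⟩
  · rintro ⟨y, rfl, h⟩
    exact ⟨y, x, h, rfl, rfl⟩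

lemma mk_mem_skewShape {l m : Fin (r + 1) → ℤ} {x : ℤ} {y : Fin (r + 1)} :
    (x, ((y : ℕ) : ℤ)) ∈ skewShape l m ↔ l y ≤ x ∧ x < m y := by
  rw [mem_skewShape]
  constructor
  · rintro ⟨z, hz, h⟩
    rwa [Fin.ext (Nat.cast_injective hz)]
  · intro h
    exact ⟨y, rfl, h⟩

lemma skewShape_eq_empty {l m : Fin (r + 1) → ℤ} : skewShape l m = ∅ ↔ m ≤ l := by
  rw [eq_empty_iff_forall_notMem]
  constructor
  · intro h y
    by_contra hy
    exact h (l y, (y : ℤ)) (mk_mem_skewShape.2 ⟨le_rfl, not_le.1 hy⟩)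
  · rintro h p hp
    obtain ⟨y, -, h1, h2⟩ := mem_skewShape.1 hp
    have : m y ≤ l y := h y
    omega

lemma skewShape_growRow (l m : Fin (r + 1) → ℤ) (y : Fin (r + 1)) :
    skewShape (growRow l y) m = (skewShape l m).erase (l y, (y : ℤ)) := by
  ext ⟨x, z⟩
  rw [mem_erase]
  constructor
  · intro h
    obtain ⟨w, hw, h1, h2⟩ := mem_skewShape.1 h
    simp only at hw h1 h2
    subst hw
    have h0 := le_growRow l y w
    refine ⟨fun h => ?_, mk_mem_skewShape.2 ⟨h0.trans h1, h2⟩⟩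
    simp only [Prod.mk.injEq, Nat.cast_inj] at h
    obtain ⟨h3, h4⟩ := h
    obtain rfl := Fin.ext h4
    simp [growRow] at h1
    omega
  · rintro ⟨hne, h⟩
    obtain ⟨w, hw, h1, h2⟩ := mem_skewShape.1 h
    simp only at hw h1 h2
    subst hw
    refine mk_mem_skewShape.2 ⟨?_, h2⟩
    unfold growRow
    split_ifs with hwy
    · subst hwy
      have : x ≠ l w := fun hx => hne (by rw [hx])
      omega
    · exact h1

lemma minimalBoxes_skewShape {l m : Fin (r + 1) → ℤ} (hl : Antitone l) (hm : Antitone m) :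
    minimalBoxes (skewShape l m) =
      ((cornerRows l).filter fun y => l y < m y).image fun y => (l y, ((y : ℕ) : ℤ)) := by
  ext ⟨x, z⟩
  simp only [minimalBoxes, mem_filter, mem_image, mem_cornerRows]
  constructor
  · rintro ⟨h, hleft, hup⟩
    obtain ⟨y, hy, h1, h2⟩ := mem_skewShape.1 h
    simp only at hy h1 h2
    subst hy
    simp only [Prod.mk_sub_mk, sub_zero, mk_mem_skewShape] at hleft
    have hx : x = l y := by omega
    refine ⟨y, ⟨fun w hw => ?_, by omega⟩, by rw [hx]⟩
    by_contra hc
    have hv : (y : ℕ) - 1 < r + 1 := by omega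
    have hw' : (w : ℕ) < y := hw
    have hcast : ((y : ℕ) : ℤ) - 1 = (((⟨(y : ℕ) - 1, hv⟩ : Fin (r + 1)) : ℕ) : ℤ) := by
      simp only
      omega
    rw [Prod.mk_sub_mk, sub_zero, hcast, mk_mem_skewShape] at hup
    have hle : (⟨(y : ℕ) - 1, hv⟩ : Fin (r + 1)) ≤ y := by
      rw [Fin.le_def]
      simp
    have hwv : w ≤ (⟨(y : ℕ) - 1, hv⟩ : Fin (r + 1)) := by
      rw [Fin.le_def]
      simp only
      omega
    have h3 := hl hwv
    have h4 := hm hle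
    omega
  · rintro ⟨y, ⟨hy, hlt⟩, heq⟩
    rw [Prod.mk.injEq] at heq
    obtain ⟨rfl, rfl⟩ := heq
    refine ⟨mk_mem_skewShape.2 ⟨le_rfl, hlt⟩, ?_, fun h => ?_⟩
    · simp only [Prod.mk_sub_mk, sub_zero, mk_mem_skewShape]
      omega
    · obtain ⟨w, hw, h1, -⟩ := mem_skewShape.1 h
      simp only [Prod.mk_sub_mk, sub_zero] at hw h1
      have := hy w (by rw [Fin.lt_def]; omega)
      omega

lemma signedCount_skewShape_succ {l m : Fin (r + 1) → ℤ} (hl : Antitone l) (hm : Antitone m)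
    (n : ℕ) : signedCount (n + 1) (skewShape l m) =
      ∑ y ∈ cornerRows l,
        (signedCount n (skewShape (growRow l y) m) - signedCount n (skewShape l m)) := by
  rw [signedCount_succ, minimalBoxes_skewShape hl hm, sum_image, sum_filter]
  · refine sum_congr rfl fun y _ => ?_
    rw [skewShape_growRow]
    split_ifs with h
    · rfl
    · rw [erase_eq_of_notMem, sub_self]
      rw [mk_mem_skewShape]
      omega
  · intro y _ z _ h
    simp only [Prod.mk.injEq, Nat.cast_inj] at h
    exact Fin.ext h.2

end SkewShapes

section Transfer

variable {r : ℕ}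

lemma boxes_subset_iff {l m : Fin (r + 1) → ℤ} : boxes r l ⊆ boxes r m ↔ l ≤ m := by
  constructor
  · intro h y
    have : (l y - 1, y) ∈ boxes r m := h (by simp [boxes])
    simp only [boxes, Set.mem_ofPred_eq] at this
    change l y ≤ m y
    omega
  · intro h b hb
    exact lt_of_lt_of_le hb (h b.2)

lemma isInwardCorner_iff {l : Fin (r + 1) → ℤ} {b : ℤ × Fin (r + 1)} :
    IsInwardCorner r l b ↔ b.1 = l b.2 ∧ IsCornerRow l b.2 := by
  obtain ⟨x, y⟩ := b
  simp only [IsInwardCorner, boxes, Set.mem_ofPred_eq, not_lt, Prod.forall, Prod.mk.injEq]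
  constructor
  · rintro ⟨h, hmin⟩
    refine ⟨(hmin (l y) y le_rfl h le_rfl).1.symm, fun z hz => ?_⟩
    by_contra hc
    exact hz.ne (hmin x z (by omega) le_rfl hz.le).2
  · rintro ⟨rfl, hy⟩
    refine ⟨le_rfl, fun x' z h1 h2 h3 => ?_⟩
    obtain rfl : z = y := by
      by_contra hzy
      have := hy z (lt_of_le_of_ne h3 hzy)
      omega
    exact ⟨by omega, rfl⟩

lemma augmentation_iff {l m : Fin (r + 1) → ℤ} :
    (boxes r m ⊆ boxes r l ∨ ∃ b, IsInwardCorner r l b ∧ boxes r m ⊆ boxes r (addBox r l b)) ↔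
      m ≤ l ∨ ∃ y, IsCornerRow l y ∧ m ≤ growRow l y := by
  simp only [boxes_subset_iff, isInwardCorner_iff]
  refine or_congr_right ⟨?_, ?_⟩
  · rintro ⟨b, ⟨-, h⟩, h'⟩
    exact ⟨b.2, h, h'⟩
  · rintro ⟨y, h, h'⟩
    exact ⟨(l y, y), ⟨rfl, h⟩, h'⟩

open Classical in
/-- Indicator that `m` is obtained from `l` by removing boxes and adding one inward corner. -/
noncomputable def augWeight (l m : Fin (r + 1) → ℤ) : ℤ :=
  if (∃ y, IsCornerRow l y ∧ m ≤ growRow l y) ∧ ¬ m ≤ l then 1 else 0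

open Classical in
lemma augWeight_eq_sum (l m : Fin (r + 1) → ℤ) :
    augWeight l m = ∑ y ∈ cornerRows l,
      ((if m ≤ growRow l y then 1 else 0) - (if m ≤ l then 1 else 0)) := by
  unfold augWeight
  by_cases hml : m ≤ l
  · rw [if_neg (fun h => h.2 hml)]
    refine (sum_eq_zero fun y _ => ?_).symm
    rw [if_pos (hml.trans (le_growRow l y)), if_pos hml, sub_self]
  · simp only [hml, not_false_eq_true, and_true, if_false, sub_zero]
    split_ifs with h
    · obtain ⟨y, hy, hmy⟩ := h
      rw [sum_eq_single_of_mem y (mem_cornerRows.2 hy), if_pos hmy]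
      intro z _ hzy
      refine if_neg fun hmz => hml fun w => ?_
      have h1 : m w ≤ growRow l y w := hmy w
      have h2 : m w ≤ growRow l z w := hmz w
      change m w ≤ l w
      unfold growRow at h1 h2
      split_ifs at h1 h2 with h3 h4
      · exact absurd (h4.symm.trans h3) hzy
      all_goals omega
    · refine (sum_eq_zero fun y hy => if_neg fun hmy => h ⟨y, mem_cornerRows.1 hy, hmy⟩).symm

/-- The set of boxes `B` contains two adjacent boxes. -/
def HasAdjacent (B : Set (ℤ × Fin (r + 1))) : Prop :=
  ∃ b ∈ B, (b.1 + 1, b.2) ∈ B ∨ ∃ y' : Fin (r + 1), (y' : ℕ) = (b.2 : ℕ) + 1 ∧ (b.1, y') ∈ B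

open Classical in
/-- The sign contributed by the left-removal of `boxes m ∖ boxes l`. -/
noncomputable def removalSign (m l : Fin (r + 1) → ℤ) : ℤ :=
  if HasAdjacent (boxes r m \ boxes r l) then 0 else (-1) ^ (boxes r m \ boxes r l).ncard

open Classical in
/-- Lengthen by one box all rows of `l` in `S`. -/
noncomputable def growRows (l : Fin (r + 1) → ℤ) (S : Finset (Fin (r + 1))) : Fin (r + 1) → ℤ :=
  fun y => if y ∈ S then l y + 1 else l y

lemma growRows_injective (l : Fin (r + 1) → ℤ) : Function.Injective (growRows l) := by
  intro S S' h
  ext y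
  have := congrFun h y
  unfold growRows at this
  split_ifs at this <;> simp_all

lemma mem_boxes_growRows_sdiff {l : Fin (r + 1) → ℤ} {S : Finset (Fin (r + 1))}
    {b : ℤ × Fin (r + 1)} :
    b ∈ boxes r (growRows l S) \ boxes r l ↔ b.2 ∈ S ∧ b.1 = l b.2 := by
  simp only [boxes, growRows, Set.mem_sdiff, Set.mem_ofPred_eq]
  split_ifs with h
  · simp only [h, true_and]
    omega
  · simp only [h, false_and, iff_false]
    omega

lemma removalSign_growRows {l : Fin (r + 1) → ℤ} {S : Finset (Fin (r + 1))}
    (hS : ∀ y ∈ S, IsCornerRow l y) : removalSign (growRows l S) l = (-1) ^ #S := by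
  unfold removalSign
  rw [if_neg]
  · congr 1
    rw [← Set.ncard_coe_finset,
      ← Set.ncard_image_of_injective (f := fun y => (l y, y)) (S : Set (Fin (r + 1)))
        (fun a b h => (Prod.mk.inj h).2)]
    congr 1
    ext ⟨x, y⟩
    rw [mem_boxes_growRows_sdiff]
    constructor
    · rintro ⟨h1, h2⟩
      exact ⟨y, h1, by simp only at h2; rw [h2]⟩
    · rintro ⟨z, h1, h2⟩
      obtain ⟨rfl, rfl⟩ := Prod.mk.inj h2
      exact ⟨h1, rfl⟩
  · rintro ⟨b, hb, h | ⟨z, hz, h⟩⟩ <;> rw [mem_boxes_growRows_sdiff] at hb h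
    · have h1 := h.2
      have h2 := hb.2
      simp only at h1
      omega
    · have h1 := h.2
      have h2 := hb.2
      have h3 := hS z h.1 b.2 (by rw [Fin.lt_def]; omega)
      simp only at h1
      omega

lemma antitone_growRows {l : Fin (r + 1) → ℤ} (hl : Antitone l) {S : Finset (Fin (r + 1))}
    (hS : ∀ y ∈ S, IsCornerRow l y) : Antitone (growRows l S) := by
  intro a b hab
  rcases hab.eq_or_lt with rfl | hlt
  · exact le_rfl
  have h := hl hab
  unfold growRows
  split_ifs with h1 h2 h2
  · omega
  · have := hS b h1 a hlt
    omega
  · omega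
  · exact h

lemma eq_growRows_of_not_hasAdjacent {l m : Fin (r + 1) → ℤ} (hl : Antitone l) (hm : Antitone m)
    (hlm : l ≤ m) (h : ¬ HasAdjacent (boxes r m \ boxes r l)) :
    m = growRows l (univ.filter fun y => l y < m y) ∧ ∀ y, l y < m y → IsCornerRow l y := by
  have hbox : ∀ x y, (x, y) ∈ boxes r m \ boxes r l ↔ l y ≤ x ∧ x < m y := by
    intro x y
    simp only [boxes, Set.mem_sdiff, Set.mem_ofPred_eq]
    omega
  constructor
  · funext y
    have h1 : l y ≤ m y := hlm y
    simp only [growRows, mem_filter, mem_univ, true_and]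
    split_ifs with hy
    · by_contra hne
      exact h ⟨(l y, y), (hbox _ _).2 ⟨le_rfl, hy⟩, Or.inl ((hbox _ _).2 (by
        simp only
        omega))⟩
    · omega
  · intro y hy z hz
    by_contra hc
    have hz' : (z : ℕ) < y := hz
    have hv : (y : ℕ) - 1 < r + 1 := by omega
    have hvy : (⟨(y : ℕ) - 1, hv⟩ : Fin (r + 1)) ≤ y := by
      rw [Fin.le_def]
      simp
    have hzv : z ≤ (⟨(y : ℕ) - 1, hv⟩ : Fin (r + 1)) := by
      rw [Fin.le_def]
      simp only
      omega
    have h1 := hl hvy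
    have h2 := hl hzv
    have h3 := hm hvy
    refine h ⟨(l y, ⟨(y : ℕ) - 1, hv⟩), (hbox _ _).2 (by omega), Or.inr ⟨y, ?_,
      (hbox _ _).2 (by omega)⟩⟩
    simp only
    omega

open Classical in
/-- The removal signs form the Möbius function of the lattice of nonincreasing tuples. -/
lemma sum_removalSign {l k : Fin (r + 1) → ℤ} (hl : Antitone l) (hk : Antitone k)
    {J : Finset (Fin (r + 1) → ℤ)} (hJ : ∀ m ∈ J, Antitone m)
    (hJ' : ∀ m, Antitone m → l ≤ m → m ≤ k → m ∈ J) :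
    ∑ m ∈ J, (if m ≤ k then 1 else 0) * (if l ≤ m then removalSign m l else 0) =
      if l = k then 1 else 0 := by
  by_cases hlk : l ≤ k
  swap
  · rw [if_neg (fun h => hlk h.le)]
    refine sum_eq_zero fun m _ => ?_
    split_ifs with h1 h2
    · exact absurd (h2.trans h1) hlk
    all_goals simp
  set C : Finset (Fin (r + 1)) := univ.filter fun y => IsCornerRow l y ∧ l y < k y with hC
  have hCS : ∀ S ∈ C.powerset, ∀ y ∈ S, IsCornerRow l y ∧ l y < k y := fun S hS y hy => by
    simpa [hC] using mem_powerset.1 hS hy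
  have hle : ∀ S, l ≤ growRows l S := fun S y => by
    change l y ≤ growRows l S y
    unfold growRows
    split_ifs <;> omega
  have hlek : ∀ S ∈ C.powerset, growRows l S ≤ k := fun S hS y => by
    have : l y ≤ k y := hlk y
    change growRows l S y ≤ k y
    unfold growRows
    split_ifs with h
    · have := (hCS S hS y h).2
      omega
    · exact this
  have hsub : C.powerset.image (growRows l) ⊆ J := by
    intro m hm
    obtain ⟨S, hS, rfl⟩ := mem_image.1 hm
    exact hJ' _ (antitone_growRows hl fun y hy => (hCS S hS y hy).1) (hle S) (hlek S hS)
  rw [← sum_subset hsub, sum_image (growRows_injective l).injOn]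
  · trans ∑ S ∈ C.powerset, (-1 : ℤ) ^ #S
    · refine sum_congr rfl fun S hS => ?_
      rw [if_pos (hlek S hS), if_pos (hle S), one_mul,
        removalSign_growRows fun y hy => (hCS S hS y hy).1]
    · rw [sum_powerset_neg_one_pow_card]
      refine if_congr ⟨fun h => ?_, fun h => ?_⟩ rfl rfl
      · by_contra hne
        have hex : (univ.filter fun y => l y < k y).Nonempty := by
          by_contra hemp
          rw [not_nonempty_iff_eq_empty, filter_eq_empty_iff] at hemp
          exact hne (le_antisymm hlk fun y => not_lt.1 (hemp (mem_univ y)))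
        set y := (univ.filter fun y => l y < k y).min' hex with hy
        have hyk : l y < k y := (mem_filter.1 (min'_mem _ hex)).2
        have : y ∈ C := by
          simp only [hC, mem_filter, mem_univ, true_and]
          refine ⟨fun z hz => ?_, hyk⟩
          have hz' : ¬ l z < k z := fun hz' =>
            absurd (min'_le _ z (mem_filter.2 ⟨mem_univ z, hz'⟩)) (not_le.2 hz)
          have := hk hz.le
          omega
        simp [h] at this
      · subst h
        simp [hC]
  · intro m hmJ hm
    by_cases hmk : m ≤ k
    · by_cases hlm : l ≤ m
      · rw [if_pos hlm, removalSign]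
        split_ifs with hadj
        · simp
        · exfalso
          obtain ⟨h1, h2⟩ := eq_growRows_of_not_hasAdjacent hl (hJ m hmJ) hlm hadj
          refine hm (mem_image.2 ⟨_, mem_powerset.2 fun y hy => ?_, h1.symm⟩)
          have hy' := (mem_filter.1 hy).2
          exact mem_filter.2 ⟨mem_univ y, h2 y hy', hy'.trans_le (hmk y)⟩
      · simp [hlm]
    · simp [hmk]

end Transfer

section Recursion

variable {r : ℕ}

/-- Prepend the pair `(l, m)` to a pontableau sequence. -/
def consSeq (l m : Fin (r + 1) → ℤ) (P : PontSeq r) : PontSeq r where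
  lam
    | 0 => 0
    | 1 => l
    | n + 2 => P.lam (n + 1)
  rho
    | 0 => 0
    | 1 => m
    | n + 2 => P.rho (n + 1)

/-- Drop the first pair of a pontableau sequence. -/
def tailSeq (P : PontSeq r) : PontSeq r where
  lam
    | 0 => 0
    | n + 1 => P.lam (n + 2)
  rho
    | 0 => 0
    | n + 1 => P.rho (n + 2)

/-- `m` is obtained from `l` by removing boxes after possibly adding one inward corner. -/
def IsAugmentation (l m : Fin (r + 1) → ℤ) : Prop :=
  m ≤ l ∨ ∃ y, IsCornerRow l y ∧ m ≤ growRow l y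

lemma IsAugmentation.le_add_one {l m : Fin (r + 1) → ℤ} (h : IsAugmentation l m)
    (y : Fin (r + 1)) : m y ≤ l y + 1 := by
  rcases h with h | ⟨z, -, h⟩
  · have : m y ≤ l y := h y
    omega
  · exact (h y).trans (growRow_le_add_one l z y)

lemma validPont_iff {g : ℕ} {P : PontSeq r} :
    ValidPont r g P ↔ (∀ n, 1 ≤ n → n ≤ g → Antitone (P.lam n) ∧ Antitone (P.rho n)) ∧
      (∀ n, 1 ≤ n → n + 1 ≤ g → P.lam (n + 1) ≤ P.rho n) ∧
      (∀ n, 1 ≤ n → n ≤ g → IsAugmentation (P.lam n) (P.rho n)) ∧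
      (∀ n, n = 0 ∨ g < n → P.lam n = 0 ∧ P.rho n = 0) := by
  simp only [ValidPont, augmentation_iff, IsAugmentation]
  simp only [boxes_subset_iff]

lemma consSeq_mem_PT {g : ℕ} {l m k e : Fin (r + 1) → ℤ} (hl : Antitone l) (hm : Antitone m)
    (hkm : k ≤ m) (hlm : IsAugmentation l m) {P : PontSeq r} (hP : P ∈ PT r (g + 1) k e) :
    consSeq l m P ∈ PT r (g + 2) l e := by
  obtain ⟨hv, h1, he⟩ := hP
  obtain ⟨hanti, hrem, haug, hnorm⟩ := validPont_iff.1 hv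
  refine ⟨validPont_iff.2 ⟨?_, ?_, ?_, ?_⟩, rfl, he⟩
  · rintro (_ | _ | n) hn hn'
    · omega
    · exact ⟨hl, hm⟩
    · exact hanti (n + 1) (by omega) (by omega)
  · rintro (_ | _ | n) hn hn'
    · omega
    · exact h1.trans_le hkm
    · exact hrem (n + 1) (by omega) (by omega)
  · rintro (_ | _ | n) hn hn'
    · omega
    · exact hlm
    · exact haug (n + 1) (by omega) (by omega)
  · rintro (_ | _ | n) hn
    · exact ⟨rfl, rfl⟩
    · omega
    · exact hnorm (n + 1) (by omega)

lemma tailSeq_mem_PT {g : ℕ} {l e : Fin (r + 1) → ℤ} {P : PontSeq r}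
    (hP : P ∈ PT r (g + 2) l e) : tailSeq P ∈ PT r (g + 1) (P.lam 2) e := by
  obtain ⟨hv, -, he⟩ := hP
  obtain ⟨hanti, hrem, haug, hnorm⟩ := validPont_iff.1 hv
  refine ⟨validPont_iff.2 ⟨?_, ?_, ?_, ?_⟩, rfl, he⟩
  · rintro (_ | n) hn hn'
    · omega
    · exact hanti (n + 2) (by omega) (by omega)
  · rintro (_ | n) hn hn'
    · omega
    · exact hrem (n + 2) (by omega) (by omega)
  · rintro (_ | n) hn hn'
    · omega
    · exact haug (n + 2) (by omega) (by omega)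
  · rintro (_ | n) hn
    · exact ⟨rfl, rfl⟩
    · exact hnorm (n + 2) (by omega)

lemma consSeq_tailSeq {g : ℕ} {l e : Fin (r + 1) → ℤ} {P : PontSeq r}
    (hP : P ∈ PT r g l e) : consSeq l (P.rho 1) (tailSeq P) = P := by
  obtain ⟨hv, h1, -⟩ := hP
  obtain ⟨h0, h0'⟩ := hv.2.2.2 0 (Or.inl rfl)
  obtain ⟨lam, rho⟩ := P
  simp only [consSeq, tailSeq, PontSeq.mk.injEq] at *
  constructor <;> funext n <;> rcases n with _ | _ | n <;> simp_all

lemma consSeq_injOn {g : ℕ} (l m k e : Fin (r + 1) → ℤ) :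
    Set.InjOn (consSeq l m) (PT r g k e) := by
  intro P hP Q hQ h
  obtain ⟨h0, h0'⟩ := hP.1.2.2.2 0 (Or.inl rfl)
  obtain ⟨h1, h1'⟩ := hQ.1.2.2.2 0 (Or.inl rfl)
  obtain ⟨lam, rho⟩ := P
  obtain ⟨lam', rho'⟩ := Q
  simp only [consSeq, PontSeq.mk.injEq] at *
  constructor
  · funext n
    rcases n with _ | n
    · rw [h0, h1]
    · exact congrFun h.1 (n + 2)
  · funext n
    rcases n with _ | n
    · rw [h0', h1']
    · exact congrFun h.2 (n + 2)

lemma rho_le_of_mem_PT {g : ℕ} {l e : Fin (r + 1) → ℤ} {P : PontSeq r}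
    (hP : P ∈ PT r (g + 1) l e) (y : Fin (r + 1)) : e y ≤ l y + (g + 1) := by
  obtain ⟨hv, h1, he⟩ := hP
  obtain ⟨-, hrem, haug, -⟩ := validPont_iff.1 hv
  have key : ∀ n : ℕ, n ≤ g → P.rho (n + 1) y ≤ l y + (n + 1) := by
    intro n hn
    induction n with
    | zero =>
      have := (haug 1 le_rfl (by omega)).le_add_one y
      rw [h1] at this
      simpa using this
    | succ n ih =>
      have h2 : P.rho (n + 2) y ≤ _ := (haug (n + 2) (by omega) (by omega)).le_add_one y
      have h3 : P.lam (n + 2) y ≤ P.rho (n + 1) y := hrem (n + 1) (by omega) (by omega) y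
      have := ih (by omega)
      change P.rho (n + 2) y ≤ _
      push_cast
      omega
  have := key g le_rfl
  rwa [he] at this

open Classical in
/-- A finite set of nonincreasing tuples containing every second pair of tuples of a pontableau
in `PT r (g + 2) l e`. -/
noncomputable def tupleRange (g : ℕ) (l e : Fin (r + 1) → ℤ) : Finset (Fin (r + 1) → ℤ) :=
  (Icc (fun y => min (l y) (e y - (g + 1))) fun y => l y + 1).filter Antitone

lemma mem_tupleRange {g : ℕ} {l e m : Fin (r + 1) → ℤ} :
    m ∈ tupleRange g l e ↔
      (∀ y, min (l y) (e y - (g + 1)) ≤ m y ∧ m y ≤ l y + 1) ∧ Antitone m := by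
  simp only [tupleRange, mem_filter, mem_Icc, Pi.le_def, forall_and]

open Classical in
/-- The possible second and third tuples of a pontableau in `PT r (g + 2) l e`. -/
noncomputable def stepPairs (g : ℕ) (l e : Fin (r + 1) → ℤ) :
    Finset ((Fin (r + 1) → ℤ) × (Fin (r + 1) → ℤ)) :=
  (tupleRange g l e ×ˢ tupleRange g l e).filter fun k => k.2 ≤ k.1 ∧ IsAugmentation l k.1

open Classical in
lemma antitone_of_mem_stepPairs {g : ℕ} {l e : Fin (r + 1) → ℤ}
    {k : (Fin (r + 1) → ℤ) × (Fin (r + 1) → ℤ)} (hk : k ∈ stepPairs g l e) : Antitone k.2 :=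
  (mem_tupleRange.1 (mem_product.1 (mem_filter.1 hk).1).2).2

lemma PT_succ (g : ℕ) {l : Fin (r + 1) → ℤ} (hl : Antitone l) (e : Fin (r + 1) → ℤ) :
    PT r (g + 2) l e =
      ⋃ k ∈ (stepPairs g l e : Set ((Fin (r + 1) → ℤ) × (Fin (r + 1) → ℤ))),
        consSeq l k.1 '' PT r (g + 1) k.2 e := by
  ext P
  simp only [Set.mem_iUnion, Set.mem_image, mem_coe, stepPairs, mem_filter, mem_product,
    exists_prop, Prod.exists]
  constructor
  · intro hP
    have htail := tailSeq_mem_PT hP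
    obtain ⟨hanti, hrem, haug, -⟩ := validPont_iff.1 hP.1
    have haug1 := haug 1 le_rfl (by omega)
    rw [hP.2.1] at haug1
    have hrem1 : P.lam 2 ≤ P.rho 1 := hrem 1 le_rfl (by omega)
    have hb : ∀ y, e y ≤ P.lam 2 y + (g + 1) := rho_le_of_mem_PT htail
    refine ⟨P.rho 1, P.lam 2, ⟨⟨mem_tupleRange.2 ⟨fun y => ?_, (hanti 1 le_rfl (by omega)).2⟩,
      mem_tupleRange.2 ⟨fun y => ?_, (hanti 2 (by omega) (by omega)).1⟩⟩, hrem1, haug1⟩,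
      tailSeq P, htail, consSeq_tailSeq hP⟩
    · have h1 := hb y
      have h2 : P.lam 2 y ≤ P.rho 1 y := hrem1 y
      exact ⟨by omega, haug1.le_add_one y⟩
    · have h1 := hb y
      have h2 : P.lam 2 y ≤ P.rho 1 y := hrem1 y
      have h3 := haug1.le_add_one y
      omega
  · rintro ⟨m, k, ⟨⟨hm, -⟩, hkm, hlm⟩, Q, hQ, rfl⟩
    exact consSeq_mem_PT hl (mem_tupleRange.1 hm).2 hkm hlm hQ

lemma PT_one {l e : Fin (r + 1) → ℤ} (hl : Antitone l) (he : Antitone e) (P : PontSeq r) :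
    P ∈ PT r 1 l e ↔ IsAugmentation l e ∧ P = consSeq l e ⟨0, 0⟩ := by
  constructor
  · intro hP
    have haug := (validPont_iff.1 hP.1).2.2.1 1 le_rfl le_rfl
    have hnorm := hP.1.2.2.2
    have h := consSeq_tailSeq hP
    rw [hP.2.1, hP.2.2] at haug
    rw [hP.2.2] at h
    refine ⟨haug, ?_⟩
    rw [← h]
    simp only [consSeq, tailSeq, PontSeq.mk.injEq]
    constructor <;> funext n <;> rcases n with _ | _ | n
    · rfl
    · rfl
    · exact (hnorm (n + 2) (by omega)).1
    · rfl
    · rfl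
    · exact (hnorm (n + 2) (by omega)).2
  · rintro ⟨haug, rfl⟩
    refine ⟨validPont_iff.2 ⟨?_, ?_, ?_, ?_⟩, rfl, rfl⟩
    · rintro (_ | _ | n) hn hn'
      · omega
      · exact ⟨hl, he⟩
      · omega
    · omega
    · rintro (_ | _ | n) hn hn'
      · omega
      · exact haug
      · omega
    · rintro (_ | _ | n) hn
      · exact ⟨rfl, rfl⟩
      · omega
      · exact ⟨rfl, rfl⟩

lemma PT_finite (g : ℕ) {l e : Fin (r + 1) → ℤ} (hl : Antitone l) (he : Antitone e) :
    (PT r (g + 1) l e).Finite := by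
  induction g generalizing l with
  | zero =>
    refine (Set.finite_singleton (consSeq l e ⟨0, 0⟩)).subset fun P hP => ?_
    exact ((PT_one hl he P).1 hP).2
  | succ g ih =>
    rw [PT_succ g hl e]
    refine Set.Finite.biUnion (Finset.finite_toSet _) fun k hk => Set.Finite.image _ (ih ?_)
    exact antitone_of_mem_stepPairs hk

lemma mu_eq_prod (g : ℕ) (P : PontSeq r) :
    mu r (g + 1) P = ∏ i ∈ range g, removalSign (P.rho (i + 1)) (P.lam (i + 2)) := by
  have hIcc : ∀ (f : ℕ → ℕ), ∑ n ∈ Icc 2 (g + 1), f n = ∑ i ∈ range g, f (i + 2) := by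
    intro f
    rw [range_eq_Ico, sum_Ico_add' f 0 g 2]
    rfl
  unfold mu
  split_ifs with h
  · obtain ⟨n, h2, hn, hadj⟩ := h
    obtain ⟨i, rfl⟩ := Nat.exists_eq_add_of_le' h2
    symm
    exact prod_eq_zero (mem_range.2 (by omega : i < g)) (if_pos hadj)
  · rw [hIcc, ← prod_pow_eq_pow_sum]
    refine prod_congr rfl fun i hi => (if_neg fun hadj => h ⟨i + 2, by omega, ?_, hadj⟩).symm
    have := mem_range.1 hi
    omega

open Classical in
/-- Indicator that some box of `m` does not lie in `l`. -/
noncomputable def notLeIndicator (m l : Fin (r + 1) → ℤ) : ℤ := if m ≤ l then 0 else 1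

open Classical in
lemma chi_eq_prod (g : ℕ) (P : PontSeq r) :
    chi r g P = ∏ i ∈ range g, notLeIndicator (P.rho (i + 1)) (P.lam (i + 1)) := by
  unfold chi
  simp only [Set.sdiff_nonempty, boxes_subset_iff]
  split_ifs with h
  · refine (prod_eq_one fun i hi => if_neg (h (i + 1) (by omega) ?_)).symm
    have := mem_range.1 hi
    omega
  · push Not at h
    obtain ⟨n, h1, hn, hle⟩ := h
    obtain ⟨i, rfl⟩ := Nat.exists_eq_add_of_le' h1
    symm
    exact prod_eq_zero (mem_range.2 (by omega : i < g)) (if_pos hle)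

lemma mu_mul_chi_consSeq (g : ℕ) (l m : Fin (r + 1) → ℤ) (P : PontSeq r) :
    mu r (g + 2) (consSeq l m P) * chi r (g + 2) (consSeq l m P) =
      notLeIndicator m l * removalSign m (P.lam 1) *
        (mu r (g + 1) P * chi r (g + 1) P) := by
  rw [mu_eq_prod, mu_eq_prod, chi_eq_prod, chi_eq_prod, prod_range_succ' _ g,
    prod_range_succ' _ (g + 1)]
  simp only [consSeq]
  ring

/-- The weighted number of pontableaux from `l` to `e`. -/
noncomputable def totalWeight (g : ℕ) (l e : Fin (r + 1) → ℤ) : ℤ :=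
  ∑ᶠ P ∈ PT r g l e, mu r g P * chi r g P

lemma totalWeight_one {l e : Fin (r + 1) → ℤ} (hl : Antitone l) (he : Antitone e) :
    totalWeight 1 l e = augWeight l e := by
  classical
  by_cases h : IsAugmentation l e
  · have : PT r 1 l e = {consSeq l e ⟨0, 0⟩} := by
      ext P
      simp [PT_one hl he, h]
    rw [totalWeight, this, finsum_mem_singleton, mu_eq_prod, chi_eq_prod]
    simp only [range_zero, prod_empty, range_one, prod_singleton, consSeq, one_mul, augWeight,
      notLeIndicator]
    unfold IsAugmentation at h
    by_cases hel : e ≤ l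
    · simp [hel]
    · simpa [hel] using (h.resolve_left hel)
  · have : PT r 1 l e = ∅ := by
      ext P
      simp [PT_one hl he, h]
    rw [totalWeight, this, finsum_mem_empty, augWeight, if_neg]
    exact fun h' => h (Or.inr h'.1)

open Classical in
lemma totalWeight_eq_sum_transfer (g : ℕ) {l e : Fin (r + 1) → ℤ} (hl : Antitone l)
    (he : Antitone e) :
    totalWeight (g + 2) l e = ∑ k ∈ tupleRange g l e,
      (∑ m ∈ tupleRange g l e, augWeight l m * if k ≤ m then removalSign m k else 0) *
        totalWeight (g + 1) k e := by
  have hfin : ∀ k ∈ (stepPairs g l e : Set ((Fin (r + 1) → ℤ) × (Fin (r + 1) → ℤ))),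
      (consSeq l k.1 '' PT r (g + 1) k.2 e).Finite := fun k hk =>
    (PT_finite g (antitone_of_mem_stepPairs hk) he).image _
  have hdisj : (stepPairs g l e : Set ((Fin (r + 1) → ℤ) × (Fin (r + 1) → ℤ))).PairwiseDisjoint
      fun k => consSeq l k.1 '' PT r (g + 1) k.2 e := by
    intro k _ k' _ hkk
    refine Set.disjoint_left.2 ?_
    rintro _ ⟨P, hP, rfl⟩ ⟨Q, hQ, h⟩
    have h1 : k'.1 = k.1 := congrArg (fun R => R.rho 1) h
    have h2 : Q.lam 1 = P.lam 1 := congrArg (fun R => R.lam 2) h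
    rw [hP.2.1, hQ.2.1] at h2
    exact hkk (Prod.ext h1.symm h2.symm)
  rw [totalWeight, PT_succ g hl e, finsum_mem_biUnion hdisj (Finset.finite_toSet _) hfin,
    finsum_mem_coe_finset, stepPairs, sum_filter]
  simp_rw [sum_mul]
  rw [← sum_product_right']
  refine sum_congr rfl fun k _ => ?_
  rw [finsum_mem_image (consSeq_injOn l k.1 k.2 e)]
  have hterm : ∑ᶠ P ∈ PT r (g + 1) k.2 e,
      mu r (g + 2) (consSeq l k.1 P) * chi r (g + 2) (consSeq l k.1 P) =
        notLeIndicator k.1 l * removalSign k.1 k.2 * totalWeight (g + 1) k.2 e := by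
    rw [totalWeight, mul_finsum_mem]
    refine finsum_mem_congr rfl fun P hP => ?_
    rw [mu_mul_chi_consSeq, hP.2.1]
  rw [hterm]
  unfold IsAugmentation augWeight notLeIndicator
  by_cases h1 : k.1 ≤ l <;> by_cases h2 : k.2 ≤ k.1 <;> simp [h1, h2]

open Classical in
lemma totalWeight_succ (g : ℕ) {l e : Fin (r + 1) → ℤ} (hl : Antitone l) (he : Antitone e) :
    totalWeight (g + 2) l e =
      ∑ y ∈ cornerRows l, (totalWeight (g + 1) (growRow l y) e - totalWeight (g + 1) l e) := by
  have hmem : ∀ m, Antitone m → l ≤ m → (∀ y, m y ≤ l y + 1) → m ∈ tupleRange g l e :=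
    fun m hm hlm hml => mem_tupleRange.2 ⟨fun y => ⟨(min_le_left _ _).trans (hlm y), hml y⟩, hm⟩
  have hlJ : l ∈ tupleRange g l e := hmem l hl le_rfl fun y => by omega
  have hupJ : ∀ y ∈ cornerRows l, growRow l y ∈ tupleRange g l e := fun y hy =>
    hmem _ (antitone_growRow hl (mem_cornerRows.1 hy)) (le_growRow l y) (growRow_le_add_one l y)
  have hmob : ∀ k ∈ tupleRange g l e, ∀ u ∈ tupleRange g l e,
      ∑ m ∈ tupleRange g l e, (if m ≤ u then 1 else 0) *
        (if k ≤ m then removalSign m k else 0) = if k = u then 1 else 0 := by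
    intro k hk u hu
    rw [mem_tupleRange] at hk hu
    refine sum_removalSign hk.2 hu.2 (fun m hm => (mem_tupleRange.1 hm).2)
      fun m hm hkm hmu => mem_tupleRange.2 ⟨fun y => ⟨(hk.1 y).1.trans (hkm y),
        le_trans (hmu y) (hu.1 y).2⟩, hm⟩
  rw [totalWeight_eq_sum_transfer g hl he]
  trans ∑ k ∈ tupleRange g l e, ∑ y ∈ cornerRows l,
      ((if k = growRow l y then 1 else 0) - if k = l then 1 else 0) * totalWeight (g + 1) k e
  · refine sum_congr rfl fun k hk => ?_
    rw [← sum_mul]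
    congr 1
    simp_rw [augWeight_eq_sum, sum_mul, sub_mul]
    rw [sum_comm]
    refine sum_congr rfl fun y hy => ?_
    rw [sum_sub_distrib, hmob k hk _ (hupJ y hy), hmob k hk _ hlJ]
  · rw [sum_comm]
    refine sum_congr rfl fun y hy => ?_
    simp_rw [sub_mul, ite_mul, one_mul, zero_mul]
    rw [sum_sub_distrib, sum_ite_eq_of_mem' _ _ _ (hupJ y hy), sum_ite_eq_of_mem' _ _ _ hlJ]

lemma totalWeight_eq_signedCount (g : ℕ) {l e : Fin (r + 1) → ℤ} (hl : Antitone l)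
    (he : Antitone e) : totalWeight (g + 1) l e = signedCount (g + 1) (skewShape l e) := by
  induction g generalizing l with
  | zero =>
    rw [totalWeight_one hl he, signedCount_skewShape_succ hl he, augWeight_eq_sum]
    simp only [signedCount_zero]
    congr! <;> exact skewShape_eq_empty.symm
  | succ g ih =>
    rw [totalWeight_succ g hl he, signedCount_skewShape_succ hl he, ih hl]
    refine sum_congr rfl fun y hy => ?_
    rw [ih (antitone_growRow hl (mem_cornerRows.1 hy))]

end Recursion

end Pont

open Pont in
/-- **Theorem.**  Fix `g ≥ 1`, `r, d ≥ 0`, nondecreasing ramification sequences `α, β`, and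
let `σ`, `λ¹`, `ρᵍ` be the associated skew shape and boundary tuples.  Then
`∑_{P ∈ PT(λ¹,ρᵍ)} μ(P)·χ(P) = (−1)^{g−|σ|} · #{standard set-valued tableaux of shape σ
with content {1,…,g}}`. -/
theorem stmt_1 (g r d : ℕ) (hg : 1 ≤ g)
    (α β : Fin (r + 1) → ℕ) (hα : Monotone α) (hβ : Monotone β) :
    (∑ᶠ P ∈ PT r g (fun y => -(α y : ℤ))
        (fun y => (g : ℤ) - d + r + (β y.rev : ℤ)), mu r g P * chi r g P) =
      (-1 : ℤ) ^ (g - (sigmaShape g r d α β).ncard) *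
        ({T : ℤ × ℤ → Finset ℕ | IsStdSVT g (sigmaShape g r d α β) T}.ncard : ℤ) := by
  have hl : Antitone fun y => -(α y : ℤ) := fun a b hab => by
    simpa using hα hab
  have he : Antitone fun y : Fin (r + 1) => (g : ℤ) - d + r + (β y.rev : ℤ) := fun a b hab => by
    have := hβ (Fin.rev_le_rev.2 hab)
    simp only
    omega
  have hσ : sigmaShape g r d α β = skewShape (fun y => -(α y : ℤ))
      fun y => (g : ℤ) - d + r + (β y.rev : ℤ) := by
    ext p
    rw [Finset.mem_coe, mem_skewShape]
    rfl
  rw [hσ, Set.ncard_coe_finset, ncard_isStdSVT, ← signedCount_eq]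
  obtain ⟨n, rfl⟩ := Nat.exists_eq_add_of_le' hg
  exact totalWeight_eq_signedCount n hl he
end

section
/- Let F : P' → P be a function between finite posets such that for every Z ∈ P there exists W ∈ P' with F^{−1}({Y ∈ P : Y ≥ Z}) = {W' ∈ P' : W' ≥ W}. Then for every Z ∈ P, μ_P(Z) = Σ_{Z' ∈ P', F(Z') = Z} μ_{P'}(Z'). -/
open Classical in
/-- The Möbius function of a finite poset, defined recursively downward from maximal
elements by `μ(Z) = 1 − ∑_{Y > Z} μ(Y)`. -/
noncomputable def mobiusOf {Q : Type*} [Fintype Q] [PartialOrder Q] (Z : Q) : ℤ :=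
  1 - ∑ Y ∈ (Finset.univ.filter (fun Y => Z < Y)).attach, mobiusOf Y.1
termination_by (Finset.univ.filter (fun Y => Z < Y)).card
decreasing_by
  have hY := Y.2
  simp only [Finset.mem_filter, Finset.mem_univ, true_and] at hY
  apply Finset.card_lt_card
  rw [Finset.ssubset_iff_of_subset]
  · exact ⟨Y.1, by simp only [Finset.mem_filter, Finset.mem_univ, true_and]; exact hY,
      by simp⟩
  · intro W hW
    simp only [Finset.mem_filter, Finset.mem_univ, true_and] at hW ⊢
    exact lt_trans hY hW

open Classical in
theorem mobiusOf_eq_one_sub_sum {Q : Type*} [Fintype Q] [PartialOrder Q] (Z : Q) :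
    mobiusOf Z = 1 - ∑ Y with Z < Y, mobiusOf Y := by
  rw [mobiusOf, Finset.sum_attach _ (fun Y => mobiusOf Y)]

open Classical in
theorem sum_eq_add_sum_lt {Q : Type*} [Fintype Q] [PartialOrder Q] (g : Q → ℤ) (Z : Q) :
    ∑ Y with Z ≤ Y, g Y = g Z + ∑ Y with Z < Y, g Y := by
  have h : ({Y | Z ≤ Y} : Finset Q) = insert Z ({Y | Z < Y} : Finset Q) := by
    ext Y
    simp [le_iff_eq_or_lt, eq_comm]
  rw [h, Finset.sum_insert (by simp)]

open Classical in
theorem sum_mobiusOf_le {Q : Type*} [Fintype Q] [PartialOrder Q] (Z : Q) :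
    ∑ Y with Z ≤ Y, mobiusOf Y = 1 := by
  rw [sum_eq_add_sum_lt, mobiusOf_eq_one_sub_sum Z]
  ring

open Classical in
theorem eq_mobiusOf_of_sum_le {Q : Type*} [Fintype Q] [PartialOrder Q] (g : Q → ℤ)
    (hg : ∀ Z, ∑ Y with Z ≤ Y, g Y = 1) (Z : Q) : mobiusOf Z = g Z := by
  induction Z using WellFoundedGT.induction with
  | ind Z ih =>
    have h : ∑ Y with Z < Y, mobiusOf Y = ∑ Y with Z < Y, g Y :=
      Finset.sum_congr rfl fun Y hY => ih Y (by simpa using hY)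
    have := hg Z
    rw [sum_eq_add_sum_lt] at this
    rw [mobiusOf_eq_one_sub_sum, h]
    linarith

/-- **Lemma.**  Let `F : P' → P` be a map of finite posets such that for every `Z ∈ P`,
`F⁻¹([Z,∞)) = [W,∞)` for some `W ∈ P'`.  Then `μ_P(Z) = ∑_{Z' ∈ F⁻¹(Z)} μ_{P'}(Z')`. -/
theorem stmt_5 {P' P : Type*} [Fintype P'] [PartialOrder P'] [Fintype P] [PartialOrder P]
    (F : P' → P) (hF : ∀ Z : P, ∃ W : P', F ⁻¹' (Set.Ici Z) = Set.Ici W) (Z : P) :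
    mobiusOf Z = ∑ᶠ Z' ∈ {Z' : P' | F Z' = Z}, mobiusOf Z' := by
  classical
  have hfib (Y : P) : ∑ᶠ Z' ∈ {Z' : P' | F Z' = Y}, mobiusOf Z' =
      ∑ Z' with F Z' = Y, mobiusOf Z' := by
    rw [← finsum_mem_coe_finset]
    simp
  rw [hfib]
  refine eq_mobiusOf_of_sum_le (fun Y => ∑ Z' with F Z' = Y, mobiusOf Z') (fun Y => ?_) Z
  obtain ⟨W, hW⟩ := hF Y
  have hmem (Z' : P') : Y ≤ F Z' ↔ W ≤ Z' := Set.ext_iff.mp hW Z'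
  rw [← sum_mobiusOf_le W]
  simp_rw [← hmem]
  rw [← Finset.sum_fiberwise_of_maps_to (t := ({X | Y ≤ X} : Finset P)) (g := F) (by simp)]
  refine Finset.sum_congr rfl fun X hX => Finset.sum_congr ?_ fun _ _ => rfl
  ext Z'
  have hX : Y ≤ X := by simpa using hX
  simp only [Finset.mem_filter, Finset.mem_univ, true_and]
  exact ⟨fun h => ⟨h ▸ hX, h⟩, And.right⟩
end

section
/- Let d ≥ 1, let σ, τ ∈ S_d, and let 1 ≤ k ≤ d. Then (σ,τ) is k-coherent if and only if for all integers a, b ≥ 0 with a + b = d, one has #{i ∈ {0,…,k−1} : σ_i ≥ a} + #{i ∈ {0,…,k−1} : τ_i ≥ b} ≤ k. -/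
namespace Coh

/-- The first `k` values `(σ_0, …, σ_{k−1})` of a permutation of `Fin d`, sorted
increasingly. -/
def sortedFirst (d : ℕ) (σ : Equiv.Perm (Fin d)) (k : ℕ) : List ℕ :=
  List.insertionSort (· ≤ ·) (((List.finRange d).take k).map fun i => (σ i : ℕ))

/-- `(σ,τ)` is `k`-coherent: with `s`, `t` the increasing rearrangements of the first `k`
values of `σ`, `τ`, one has `s_i + t_{k−1−i} < d` for all `0 ≤ i ≤ k−1`. -/
def KCoherent (d : ℕ) (σ τ : Equiv.Perm (Fin d)) (k : ℕ) : Prop :=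
  ∀ i : ℕ, i < k →
    (sortedFirst d σ k).getD i 0 + (sortedFirst d τ k).getD (k - 1 - i) 0 < d

/-- `(σ,τ)` is coherent: it is `k`-coherent for all `k = 1, …, d`. -/
def Coherent (d : ℕ) (σ τ : Equiv.Perm (Fin d)) : Prop :=
  ∀ k : ℕ, 1 ≤ k → k ≤ d → KCoherent d σ τ k

/-- A move on a pair of permutations: if `σ_i < σ_{i+1}` exchange `τ_i` and `τ_{i+1}`,
or if `τ_i < τ_{i+1}` exchange `σ_i` and `σ_{i+1}`. -/
def IsMove (d : ℕ) (p q : Equiv.Perm (Fin d) × Equiv.Perm (Fin d)) : Prop :=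
  ∃ i : ℕ, ∃ h : i + 1 < d,
    (p.1 ⟨i, by omega⟩ < p.1 ⟨i + 1, h⟩ ∧
      q = (p.1, p.2 * Equiv.swap ⟨i, by omega⟩ ⟨i + 1, h⟩)) ∨
    (p.2 ⟨i, by omega⟩ < p.2 ⟨i + 1, h⟩ ∧
      q = (p.1 * Equiv.swap ⟨i, by omega⟩ ⟨i + 1, h⟩, p.2))

end Coh

namespace Coh

theorem le_getD_iff_of_pairwise_le {l : List ℕ} (hl : l.Pairwise (· ≤ ·)) (a : ℕ) {i : ℕ}
    (hi : i < l.length) :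
    a ≤ l.getD i 0 ↔ l.length - i ≤ l.countP (fun x => decide (a ≤ x)) := by
  induction l generalizing i with
  | nil => simp at hi
  | cons x l ih =>
    rw [List.pairwise_cons] at hl
    by_cases hx : a ≤ x
    · have hall : ∀ y ∈ x :: l, a ≤ y := by
        simpa [hx] using fun y hy => hx.trans (hl.1 y hy)
      have hcount : (x :: l).countP (fun x => decide (a ≤ x)) = (x :: l).length := by
        rw [List.countP_eq_length]
        simpa using hall
      rw [hcount, List.getD_eq_getElem _ _ hi]
      simp [hall _ (List.getElem_mem hi)]
    · have hcount : l.countP (fun x => decide (a ≤ x)) ≤ l.length := List.countP_le_length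
      cases i with
      | zero => simp [hx]; omega
      | succ i =>
        have := ih hl.2 (i := i) (by simpa using hi)
        simpa [hx] using this

theorem mem_take_finRange {d k : ℕ} (i : Fin d) :
    i ∈ (List.finRange d).take k ↔ (i : ℕ) < k := by
  rw [List.mem_take_iff_getElem]
  constructor
  · rintro ⟨j, hj, rfl⟩
    simp at hj ⊢
    omega
  · intro h
    exact ⟨i, by simp [h], by simp⟩

theorem pairwise_sortedFirst (d : ℕ) (σ : Equiv.Perm (Fin d)) (k : ℕ) :
    (sortedFirst d σ k).Pairwise (· ≤ ·) :=
  List.pairwise_insertionSort _ _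

theorem length_sortedFirst {d k : ℕ} (σ : Equiv.Perm (Fin d)) (hk : k ≤ d) :
    (sortedFirst d σ k).length = k := by
  simp [sortedFirst, List.length_insertionSort, hk]

theorem lt_of_mem_sortedFirst {d k x : ℕ} {σ : Equiv.Perm (Fin d)}
    (hx : x ∈ sortedFirst d σ k) : x < d := by
  rw [sortedFirst, List.mem_insertionSort, List.mem_map] at hx
  obtain ⟨i, -, rfl⟩ := hx
  exact (σ i).isLt

theorem countP_sortedFirst (d : ℕ) (σ : Equiv.Perm (Fin d)) (k a : ℕ) :
    (sortedFirst d σ k).countP (fun x => decide (a ≤ x)) =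
      ((Finset.univ : Finset (Fin d)).filter
        fun i : Fin d => (i : ℕ) < k ∧ a ≤ (σ i : ℕ)).card := by
  rw [sortedFirst, (List.perm_insertionSort _ _).countP_eq, List.countP_map,
    List.countP_eq_length_filter, ← List.toFinset_card_of_nodup
      (((List.nodup_finRange d).sublist (List.take_sublist _ _)).filter _)]
  congr 1
  ext i
  simp [mem_take_finRange]

theorem le_getD_sortedFirst_iff {d k : ℕ} (σ : Equiv.Perm (Fin d)) (hk : k ≤ d) (a : ℕ) {i : ℕ}
    (hi : i < k) :
    a ≤ (sortedFirst d σ k).getD i 0 ↔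
      k - i ≤ ((Finset.univ : Finset (Fin d)).filter
        fun i : Fin d => (i : ℕ) < k ∧ a ≤ (σ i : ℕ)).card := by
  have hlen := length_sortedFirst σ hk
  rw [le_getD_iff_of_pairwise_le (pairwise_sortedFirst d σ k) a (by omega), hlen,
    countP_sortedFirst]

theorem card_filter_le {d k : ℕ} (σ : Equiv.Perm (Fin d)) (hk : k ≤ d) (a : ℕ) :
    ((Finset.univ : Finset (Fin d)).filter
      fun i : Fin d => (i : ℕ) < k ∧ a ≤ (σ i : ℕ)).card ≤ k := by
  rw [← countP_sortedFirst]
  exact List.countP_le_length.trans_eq (length_sortedFirst σ hk)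

end Coh

open Coh in
/-- **Observation.**  For `1 ≤ k ≤ d`, the pair `(σ,τ)` is `k`-coherent iff for all
`a, b ≥ 0` with `a + b = d`, `#{i ∈ [k] : σ_i ≥ a} + #{i ∈ [k] : τ_i ≥ b} ≤ k`. -/
theorem stmt_7 (d : ℕ) (hd : 1 ≤ d) (σ τ : Equiv.Perm (Fin d)) (k : ℕ)
    (hk1 : 1 ≤ k) (hk2 : k ≤ d) :
    KCoherent d σ τ k ↔
      ∀ a b : ℕ, a + b = d →
        ((Finset.univ : Finset (Fin d)).filter fun i : Fin d => (i : ℕ) < k ∧ a ≤ (σ i : ℕ)).card +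
        ((Finset.univ : Finset (Fin d)).filter fun i : Fin d => (i : ℕ) < k ∧ b ≤ (τ i : ℕ)).card
          ≤ k := by
  constructor
  · intro h a b hab
    by_contra! hlt
    have hA := card_filter_le σ hk2 a
    have hB := card_filter_le τ hk2 b
    set A := ((Finset.univ : Finset (Fin d)).filter
      fun i : Fin d => (i : ℕ) < k ∧ a ≤ (σ i : ℕ)).card
    have hs := (le_getD_sortedFirst_iff σ hk2 a (i := k - A) (by omega)).2 (by omega)
    have ht := (le_getD_sortedFirst_iff τ hk2 b (i := k - 1 - (k - A)) (by omega)).2 (by omega)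
    have := h (k - A) (by omega)
    omega
  · intro h i hi
    by_contra! hle
    have hsd : (sortedFirst d σ k).getD i 0 < d := by
      have hi' : i < (sortedFirst d σ k).length := by rwa [length_sortedFirst σ hk2]
      rw [List.getD_eq_getElem _ _ hi']
      exact lt_of_mem_sortedFirst (List.getElem_mem hi')
    set s := (sortedFirst d σ k).getD i 0 with hs'
    have hs := (le_getD_sortedFirst_iff σ hk2 s hi).1 hs'.le
    have ht := (le_getD_sortedFirst_iff τ hk2 (d - s) (i := k - 1 - i) (by omega)).1 (by omega)
    have := h s (d - s) (by omega)
    omega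
end

section
/- Let d ≥ 1, let (σ,τ) ∈ S_d × S_d, and let k ∈ {1,…,d−1} be such that σ_{k−1} < σ_k. Let τ' be obtained from τ by exchanging the values τ_{k−1} and τ_k. Then (σ,τ') is coherent if and only if (σ,τ) is coherent. The analogous statement with the roles of σ and τ reversed also holds. -/
namespace Coh

/-- The number of indices `i < k` with `σ_i < x`. -/
def countBelow (d : ℕ) (σ : Equiv.Perm (Fin d)) (k x : ℕ) : ℕ :=
  ((List.finRange d).take k).countP fun i => (σ i : ℕ) < x

theorem countBelow_succ {d : ℕ} (σ : Equiv.Perm (Fin d)) {k : ℕ} (hk : k < d) (x : ℕ) :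
    countBelow d σ (k + 1) x = countBelow d σ k x + if (σ ⟨k, hk⟩ : ℕ) < x then 1 else 0 := by
  have h : (List.finRange d).take (k + 1) = (List.finRange d).take k ++ [⟨k, hk⟩] := by
    rw [List.take_succ_eq_append_getElem (by simpa using hk)]
    simp
  simp [countBelow, h, List.countP_append, List.countP_singleton]

/-- In a sorted list, the `i`-th entry is below `x` iff more than `i` entries are below `x`. -/
theorem _root_.List.Pairwise.getD_lt_iff_lt_countP {l : List ℕ} (hl : l.Pairwise (· ≤ ·))
    (x : ℕ) {i : ℕ} (hi : i < l.length) :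
    l.getD i 0 < x ↔ i < l.countP (· < x) := by
  induction l generalizing i with
  | nil => simp at hi
  | cons a l ih =>
    rw [List.pairwise_cons] at hl
    by_cases ha : a < x
    · cases i with
      | zero => simp [ha]
      | succ i =>
        have := ih hl.2 (i := i) (by simpa using hi)
        simpa [ha] using this
    · have h0 : (a :: l).countP (· < x) = 0 := by
        simp only [List.countP_eq_zero, List.mem_cons, decide_eq_true_eq, not_lt]
        rintro b (rfl | hb)
        · omega
        · have := hl.1 b hb
          omega
      rw [h0]
      cases i with
      | zero => simpa using ha
      | succ i =>
        have hi' : i < l.length := by simpa using hi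
        have := hl.1 (l[i]) (List.getElem_mem hi')
        simp only [List.getD_cons_succ, List.getD_eq_getElem _ _ hi', not_lt_zero, iff_false]
        omega

theorem sortedFirst_getD_lt_iff {d : ℕ} (σ : Equiv.Perm (Fin d)) {k i : ℕ} (hk : k ≤ d)
    (hi : i < k) (x : ℕ) :
    (sortedFirst d σ k).getD i 0 < x ↔ i < countBelow d σ k x := by
  have hlen : (sortedFirst d σ k).length = k := by
    simp [sortedFirst, hk]
  have hsort : (sortedFirst d σ k).Pairwise (· ≤ ·) := List.pairwise_insertionSort _ _
  rw [hsort.getD_lt_iff_lt_countP x (by omega), sortedFirst,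
    (List.perm_insertionSort _ _).countP_eq, List.countP_map]
  rfl

theorem kCoherent_iff {d : ℕ} (σ τ : Equiv.Perm (Fin d)) {k : ℕ} (hk : k ≤ d) :
    KCoherent d σ τ k ↔
      ∀ x y : ℕ, x + y = d → k ≤ countBelow d σ k x + countBelow d τ k y := by
  constructor
  · intro h x y hxy
    by_contra hlt
    have hs := sortedFirst_getD_lt_iff σ hk (i := countBelow d σ k x) (by omega) x
    have ht := sortedFirst_getD_lt_iff τ hk (i := k - 1 - countBelow d σ k x) (by omega) y
    have := h (countBelow d σ k x) (by omega)
    omega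
  · intro h i hi
    by_contra hge
    rcases le_total (sortedFirst d σ k |>.getD i 0) d with hd | hd
    · have hs := sortedFirst_getD_lt_iff σ hk hi ((sortedFirst d σ k).getD i 0)
      have ht := sortedFirst_getD_lt_iff τ hk (i := k - 1 - i) (by omega)
        (d - (sortedFirst d σ k).getD i 0)
      have := h ((sortedFirst d σ k).getD i 0) (d - (sortedFirst d σ k).getD i 0) (by omega)
      omega
    · have hs := sortedFirst_getD_lt_iff σ hk hi d
      have ht := sortedFirst_getD_lt_iff τ hk (i := k - 1 - i) (by omega) 0
      have := h d 0 (by omega)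
      omega

theorem Coherent.symm {d : ℕ} {σ τ : Equiv.Perm (Fin d)} (h : Coherent d σ τ) :
    Coherent d τ σ := by
  intro k hk1 hk2
  refine (kCoherent_iff τ σ hk2).2 fun x y hxy => ?_
  have := (kCoherent_iff σ τ hk2).1 (h k hk1 hk2) y x (by omega)
  omega

theorem coherent_comm {d : ℕ} {σ τ : Equiv.Perm (Fin d)} :
    Coherent d σ τ ↔ Coherent d τ σ :=
  ⟨Coherent.symm, Coherent.symm⟩

/-- Exchanging the entries in positions `j` and `j + 1` only affects the prefix of length
`j + 1`. -/
theorem countBelow_mul_swap {d : ℕ} (τ : Equiv.Perm (Fin d)) {j : ℕ} (hj : j + 1 < d) (y : ℕ)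
    {m : ℕ} (hm : m ≤ d) (hne : m ≠ j + 1) :
    countBelow d (τ * Equiv.swap ⟨j, by omega⟩ ⟨j + 1, hj⟩) m y = countBelow d τ m y := by
  have hlow : ∀ m ≤ j,
      countBelow d (τ * Equiv.swap ⟨j, by omega⟩ ⟨j + 1, hj⟩) m y = countBelow d τ m y := by
    intro m
    induction m with
    | zero => simp [countBelow]
    | succ m ih =>
      intro h
      rw [countBelow_succ _ (by omega), countBelow_succ _ (by omega), ih (by omega),
        Equiv.Perm.mul_apply, Equiv.swap_apply_of_ne_of_ne] <;>
      · rw [Ne, Fin.mk.injEq]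
        omega
  rcases Nat.lt_or_ge j m with h | h
  · obtain ⟨n, rfl⟩ := Nat.exists_eq_add_of_le (show j + 2 ≤ m by omega)
    clear hne h
    induction n with
    | zero =>
      simp only [add_zero]
      rw [countBelow_succ _ hj, countBelow_succ _ hj, countBelow_succ _ (by omega),
        countBelow_succ _ (by omega), hlow j le_rfl, Equiv.Perm.mul_apply, Equiv.Perm.mul_apply,
        Equiv.swap_apply_left, Equiv.swap_apply_right]
      omega
    | succ n ih =>
      rw [← add_assoc, countBelow_succ _ (by omega), countBelow_succ _ (by omega),
        ih (by omega) hlow, Equiv.Perm.mul_apply, Equiv.swap_apply_of_ne_of_ne] <;>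
      · rw [Ne, Fin.mk.injEq]
        omega
  · exact hlow m h

/-- At an ascent `σ_j < σ_{j+1}`, coherence of the prefixes of lengths `j` and `j + 2` forces
coherence of the prefix of length `j + 1`. -/
theorem KCoherent.of_ascent {d : ℕ} {σ τ : Equiv.Perm (Fin d)} {j : ℕ} (hj : j + 1 < d)
    (hσ : σ ⟨j, by omega⟩ < σ ⟨j + 1, hj⟩) (h₁ : KCoherent d σ τ j)
    (h₂ : KCoherent d σ τ (j + 2)) : KCoherent d σ τ (j + 1) := by
  rw [kCoherent_iff _ _ (by omega)] at h₁ h₂ ⊢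
  intro x y hxy
  have h₁ := h₁ x y hxy
  have h₂ := h₂ x y hxy
  rw [countBelow_succ _ hj, countBelow_succ _ hj, countBelow_succ _ (by omega),
    countBelow_succ _ (by omega)] at h₂
  rw [countBelow_succ _ (by omega), countBelow_succ _ (by omega)]
  rw [Fin.lt_def] at hσ
  split_ifs at * <;> omega

theorem Coherent.mul_swap {d : ℕ} {σ τ : Equiv.Perm (Fin d)} {j : ℕ} (hj : j + 1 < d)
    (hσ : σ ⟨j, by omega⟩ < σ ⟨j + 1, hj⟩) (h : Coherent d σ τ) :
    Coherent d σ (τ * Equiv.swap ⟨j, by omega⟩ ⟨j + 1, hj⟩) := by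
  have key : ∀ m ≤ d, m ≠ j + 1 →
      KCoherent d σ (τ * Equiv.swap ⟨j, by omega⟩ ⟨j + 1, hj⟩) m := by
    intro m hm hne
    rcases Nat.eq_zero_or_pos m with rfl | hpos
    · intro i hi
      omega
    · rw [kCoherent_iff _ _ hm]
      intro x y hxy
      rw [countBelow_mul_swap τ hj y hm hne]
      exact (kCoherent_iff _ _ hm).1 (h m hpos hm) x y hxy
  intro m _ hm
  by_cases hne : m = j + 1
  · subst hne
    exact KCoherent.of_ascent hj hσ (key j (by omega) (by omega)) (key (j + 2) hj (by omega))
  · exact key m hm hne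

theorem coherent_mul_swap_iff {d : ℕ} {σ τ : Equiv.Perm (Fin d)} {j : ℕ} (hj : j + 1 < d)
    (hσ : σ ⟨j, by omega⟩ < σ ⟨j + 1, hj⟩) :
    Coherent d σ (τ * Equiv.swap ⟨j, by omega⟩ ⟨j + 1, hj⟩) ↔ Coherent d σ τ := by
  refine ⟨fun h => ?_, Coherent.mul_swap hj hσ⟩
  simpa [mul_assoc] using h.mul_swap hj hσ

end Coh

open Coh in
/-- **Lemma.**  Let `k ∈ {1,…,d−1}` with `σ_{k−1} < σ_k`, and let `τ'` be obtained from
`τ` by exchanging `τ_{k−1}` and `τ_k`.  Then `(σ,τ')` is coherent iff `(σ,τ)` is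
coherent; the analogous statement with the roles of `σ` and `τ` reversed also holds. -/
theorem stmt_9 (d : ℕ) (hd : 1 ≤ d) (σ τ : Equiv.Perm (Fin d)) (k : ℕ)
    (hk1 : 1 ≤ k) (hk2 : k ≤ d - 1) :
    ((σ ⟨k - 1, by omega⟩ < σ ⟨k, by omega⟩ →
      (Coherent d σ (τ * Equiv.swap ⟨k - 1, by omega⟩ ⟨k, by omega⟩) ↔
        Coherent d σ τ)) ∧
     (τ ⟨k - 1, by omega⟩ < τ ⟨k, by omega⟩ →
      (Coherent d (σ * Equiv.swap ⟨k - 1, by omega⟩ ⟨k, by omega⟩) τ ↔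
        Coherent d σ τ))) := by
  obtain ⟨j, rfl⟩ := Nat.exists_eq_add_of_le' hk1
  have hj : j + 1 < d := by omega
  refine ⟨fun h => coherent_mul_swap_iff hj h, fun h => ?_⟩
  rw [coherent_comm, coherent_comm (σ := σ)]
  exact coherent_mul_swap_iff hj h
end
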